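/- For every ϑ with 1/3 < ϑ < 1/2 there exists G′ > 0 such that, for all constants 0 < c₁ < c₂, one has J_{sgn,d₃}(N,H) ≪ N·H^{2−G′} for all positive integers N, H with c₁·N^ϑ ≤ H ≤ c₂·N^ϑ, where d₃(n) = Σ_{abc=n} 1 is the 3-fold divisor function. -/

import Mathlib

/-- sgn(0)=0, sgn(t)=t/|t| for t≠0. -/
noncomputable def sgn (t : ℤ) : ℝ := if 0 < t then 1 else if t < 0 then -1 else 0

/-- The symmetry integral `J_{sgn,f}(N,H)`. -/
noncomputable def Jsgn (f : ℕ → ℝ) (N H : ℕ) : ℝ :=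
  ∑ x ∈ Finset.Ioc N (2 * N),
    (∑ n ∈ Finset.Icc (x - H) (x + H), f n * sgn ((n : ℤ) - (x : ℤ))) ^ 2

/-- The 3-fold divisor function `d₃(n) = Σ_{abc = n} 1`. -/
def d3 (n : ℕ) : ℕ :=
  ((Finset.Icc 1 n ×ˢ Finset.Icc 1 n ×ˢ Finset.Icc 1 n).filter
    (fun t => t.1 * t.2.1 * t.2.2 = n)).card

/-- The divisor bound `d(n) ≪ n ^ ε`. -/
theorem exists_card_divisors_le_rpow (ε : ℝ) (hε : 0 < ε) :
    ∃ C : ℝ, 1 ≤ C ∧ ∀ n : ℕ, n ≠ 0 → (n.divisors.card : ℝ) ≤ C * (n : ℝ) ^ ε := by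
  obtain ⟨P, hP⟩ := exists_nat_gt ((2 : ℝ) ^ (1 / ε))
  set c := ε * Real.log 2 with hc
  have hc0 : 0 < c := mul_pos hε (Real.log_pos (by norm_num))
  set M := 1 + 1 / c with hM
  have hM1 : 1 ≤ M := by have := one_div_pos.2 hc0; linarith
  have small : ∀ p k : ℕ, 2 ≤ p → (k + 1 : ℝ) ≤ M * ((p : ℝ) ^ k) ^ ε := by
    intro p k hp
    have h1 : (2 : ℝ) ^ (k * ε) ≤ ((p : ℝ) ^ k) ^ ε := by
      rw [← Real.rpow_natCast, ← Real.rpow_mul (by positivity)]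
      exact Real.rpow_le_rpow (by norm_num) (by exact_mod_cast hp) (by positivity)
    have h2 : 1 + k * c ≤ (2 : ℝ) ^ (k * ε) := by
      rw [Real.rpow_def_of_pos (by norm_num)]
      have := Real.add_one_le_exp (k * c)
      rw [hc] at this ⊢
      calc _ ≤ _ := by linarith
        _ ≤ _ := this
        _ = _ := by congr 1; ring
    calc (k + 1 : ℝ) ≤ M * (1 + k * c) := by
          rw [hM]
          have : (1 + 1 / c) * (1 + k * c) = 1 + k + k * c + 1 / c := by field_simp; ring
          rw [this]
          have := one_div_pos.2 hc0
          have : 0 ≤ k * c := by positivity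
          linarith
      _ ≤ _ := by gcongr; exact h2.trans h1
  have large : ∀ p k : ℕ, P ≤ p → (k + 1 : ℝ) ≤ ((p : ℝ) ^ k) ^ ε := by
    intro p k hp
    have h0 : (2 : ℝ) ≤ (p : ℝ) ^ ε := by
      have : (2 : ℝ) ^ (1 / ε) ≤ p := hP.le.trans (by exact_mod_cast hp)
      calc (2 : ℝ) = ((2 : ℝ) ^ (1 / ε)) ^ ε := by
            rw [← Real.rpow_mul (by norm_num), one_div_mul_cancel hε.ne', Real.rpow_one]
        _ ≤ _ := Real.rpow_le_rpow (by positivity) this hε.le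
    have h1 : ((p : ℝ) ^ k) ^ ε = ((p : ℝ) ^ ε) ^ k := by
      rw [← Real.rpow_natCast, ← Real.rpow_mul (by positivity), mul_comm,
        Real.rpow_mul (by positivity), Real.rpow_natCast]
    rw [h1]
    calc (k + 1 : ℝ) ≤ 2 ^ k := by exact_mod_cast Nat.lt_two_pow_self
      _ ≤ _ := by gcongr
  refine ⟨M ^ P, one_le_pow₀ hM1, fun n hn => ?_⟩
  rw [Nat.card_divisors hn]
  push_cast
  calc ∏ p ∈ n.primeFactors, ((n.factorization p : ℝ) + 1)
      ≤ ∏ p ∈ n.primeFactors, ((if p < P then M else 1) *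
          ((p : ℝ) ^ n.factorization p) ^ ε) := by
        refine Finset.prod_le_prod (fun _ _ => by positivity) fun p hp => ?_
        split_ifs with h
        · exact small p _ (Nat.prime_of_mem_primeFactors hp).two_le
        · rw [one_mul]; exact large p _ (not_lt.1 h)
    _ = (∏ p ∈ n.primeFactors, (if p < P then M else 1)) *
          (∏ p ∈ n.primeFactors, ((p : ℝ) ^ n.factorization p)) ^ ε := by
        rw [Finset.prod_mul_distrib, Real.finsetProd_rpow _ _ (fun _ _ => by positivity)]
    _ ≤ M ^ P * (n : ℝ) ^ ε := by
        have h1 : ∏ p ∈ n.primeFactors, ((p : ℝ) ^ n.factorization p) = n := by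
          conv_rhs => rw [← Nat.prod_factorization_pow_eq_self hn]
          rw [Finsupp.prod, Nat.support_factorization]
          push_cast
          rfl
        rw [h1]
        gcongr
        rw [Finset.prod_ite, Finset.prod_const, Finset.prod_const_one, mul_one]
        refine pow_le_pow_right₀ hM1 ?_
        calc _ ≤ (Finset.range P).card := Finset.card_le_card (by intro p; simp)
          _ = P := Finset.card_range P

/-- The additive character `e(θ) = exp (2πiθ)`. -/
noncomputable def eChar (θ : ℝ) : ℂ := Complex.exp (Complex.I * ((2 * Real.pi * θ : ℝ) : ℂ))

theorem eChar_add (a b : ℝ) : eChar (a + b) = eChar a * eChar b := by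
  rw [eChar, eChar, eChar, ← Complex.exp_add]; congr 1; push_cast; ring

theorem eChar_intCast (n : ℤ) : eChar n = 1 := by
  rw [eChar, Complex.exp_eq_one_iff]
  exact ⟨n, by push_cast; ring⟩

theorem eChar_zero : eChar 0 = 1 := by simpa using eChar_intCast 0

theorem norm_eChar (θ : ℝ) : ‖eChar θ‖ = 1 := by
  rw [eChar, mul_comm]; exact Complex.norm_exp_ofReal_mul_I _

theorem conj_eChar (θ : ℝ) : (starRingEnd ℂ) (eChar θ) = eChar (-θ) := by
  rw [eChar, eChar, ← Complex.exp_conj, map_mul, Complex.conj_I, Complex.conj_ofReal]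
  congr 1; push_cast; ring

theorem eChar_natCast_mul (n : ℕ) (θ : ℝ) : eChar (n * θ) = eChar θ ^ n := by
  rw [eChar, eChar, ← Complex.exp_nat_mul]; congr 1; push_cast; ring

theorem eChar_fract (θ : ℝ) : eChar (Int.fract θ) = eChar θ := by
  conv_rhs => rw [← Int.fract_add_floor θ, eChar_add, eChar_intCast, mul_one]

theorem norm_eChar_sub_one (θ : ℝ) : ‖eChar θ - 1‖ = 2 * |Real.sin (Real.pi * θ)| := by
  rw [eChar, Complex.norm_exp_I_mul_ofReal_sub_one, Real.norm_eq_abs, abs_mul]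
  congr 2
  · norm_num
  · congr 1; ring

theorem two_mul_mul_one_sub_le_sin {γ : ℝ} (h0 : 0 ≤ γ) (h1 : γ ≤ 1) :
    2 * (γ * (1 - γ)) ≤ Real.sin (Real.pi * γ) := by
  have key : ∀ t : ℝ, 0 ≤ t → t ≤ 1 / 2 → 2 * t ≤ Real.sin (Real.pi * t) := by
    intro t ht ht'
    have := Real.mul_le_sin (x := Real.pi * t) (by positivity)
      (by nlinarith [Real.pi_pos])
    have h : 2 / Real.pi * (Real.pi * t) = 2 * t := by field_simp
    linarith
  rcases le_total γ (1 / 2) with h | h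
  · nlinarith [key γ h0 h]
  · have := key (1 - γ) (by linarith) (by linarith)
    rw [show Real.pi * (1 - γ) = Real.pi - Real.pi * γ by ring, Real.sin_pi_sub] at this
    nlinarith

/-- A bound for exponential sums with frequency `θ ∉ ℤ` over intervals. -/
theorem norm_sum_Ico_eChar_le (θ : ℝ) (hθ : Int.fract θ ≠ 0) (m n : ℕ) :
    ‖∑ x ∈ Finset.Ico m n, eChar (x * θ)‖ ≤ 1 / Int.fract θ + 1 / (1 - Int.fract θ) := by
  set γ := Int.fract θ with hγ
  have g0 : 0 < γ := lt_of_le_of_ne (Int.fract_nonneg θ) (Ne.symm hθ)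
  have g1 : 0 < 1 - γ := by linarith [Int.fract_lt_one θ]
  have low : 4 * (γ * (1 - γ)) ≤ ‖eChar θ - 1‖ := by
    rw [← eChar_fract, norm_eChar_sub_one]
    linarith [two_mul_mul_one_sub_le_sin g0.le (by linarith), le_abs_self (Real.sin (Real.pi * γ))]
  have pos : 0 < ‖eChar θ - 1‖ := lt_of_lt_of_le (by positivity) low
  have e1 : 1 / γ + 1 / (1 - γ) = 1 / (γ * (1 - γ)) := by field_simp; ring
  rw [e1, le_div_iff₀ (by positivity)]
  simp only [eChar_natCast_mul]
  rcases le_total n m with h | h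
  · rw [Finset.Ico_eq_empty_of_le h]; simp
  have hs := geom_sum_Ico_mul (eChar θ) h
  have : ‖∑ i ∈ Finset.Ico m n, eChar θ ^ i‖ * ‖eChar θ - 1‖ ≤ 2 := by
    rw [← norm_mul, hs]
    refine (norm_sub_le _ _).trans ?_
    simp [norm_eChar]; norm_num
  nlinarith [norm_nonneg (∑ i ∈ Finset.Ico m n, eChar θ ^ i), mul_le_mul_of_nonneg_left low (norm_nonneg (∑ i ∈ Finset.Ico m n, eChar θ ^ i))]

/-- Orthogonality of the additive characters modulo `q`. -/
theorem sum_range_eChar_div (q : ℕ) (hq : q ≠ 0) (n : ℤ) :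
    ∑ j ∈ Finset.range q, eChar ((j / q : ℝ) * n) = if (q : ℤ) ∣ n then (q : ℂ) else 0 := by
  have hq' : (q : ℝ) ≠ 0 := by exact_mod_cast hq
  have h : ∀ j : ℕ, eChar ((j / q : ℝ) * n) = eChar (n / q) ^ j := by
    intro j; rw [← eChar_natCast_mul]; congr 1; ring
  simp only [h]
  split_ifs with hd
  · obtain ⟨k, rfl⟩ := hd
    have : (((q : ℤ) * k : ℤ) : ℝ) / q = k := by push_cast; field_simp
    rw [this, eChar_intCast]; simp
  · have hne : eChar (n / q) ≠ 1 := by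
      intro h1
      rw [eChar, Complex.exp_eq_one_iff] at h1
      obtain ⟨k, hk⟩ := h1
      apply hd
      refine ⟨k, ?_⟩
      have h2 : Complex.I * (2 * Real.pi) * ((n / q : ℝ) : ℂ) = Complex.I * (2 * Real.pi) * (k : ℂ) := by
        push_cast at hk ⊢; linear_combination hk
      have h3 := mul_left_cancel₀ (by simp [Real.pi_ne_zero]) h2
      have h4 : (n / q : ℝ) = k := by exact_mod_cast h3
      rw [div_eq_iff hq'] at h4
      have : (n : ℝ) = ((q * k : ℤ) : ℝ) := by push_cast; linarith
      exact_mod_cast this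
    have h5 := geom_sum_mul (eChar (n / q)) q
    have h6 : eChar (n / q) ^ q = 1 := by
      rw [← eChar_natCast_mul, mul_div_cancel₀ _ hq', eChar_intCast]
    rw [h6, sub_self] at h5
    exact (mul_eq_zero.1 h5).resolve_right (sub_ne_zero.2 hne)

/-- The rationals in `[0, 1)` with denominator at most `Q`. -/
def farey (Q : ℕ) : Finset ℚ :=
  (Finset.Icc 1 Q).biUnion fun q => (Finset.range q).image fun j : ℕ => (j / q : ℚ)

theorem image_div_range (q : ℕ) (α : ℚ) :
    α ∈ (Finset.range q).image (fun j : ℕ => (j / q : ℚ)) ↔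
      0 ≤ α ∧ α < 1 ∧ α.den ∣ q ∧ q ≠ 0 := by
  simp only [Finset.mem_image, Finset.mem_range]
  constructor
  · rintro ⟨j, hj, rfl⟩
    have hq : (0 : ℚ) < q := by exact_mod_cast (Nat.zero_le j).trans_lt hj
    refine ⟨by positivity, ?_, ?_, by omega⟩
    · rw [div_lt_one hq]; exact_mod_cast hj
    · have := Rat.den_dvd (j : ℤ) (q : ℤ)
      rw [Rat.divInt_eq_div] at this
      push_cast at this
      exact Int.natCast_dvd_natCast.1 this
  · rintro ⟨h0, h1, ⟨k, hk⟩, hq⟩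
    have hd : (α.den : ℚ) ≠ 0 := by exact_mod_cast α.den_ne_zero
    have hk0 : k ≠ 0 := by rintro rfl; simp at hk; exact hq hk
    have hk0' : (k : ℚ) ≠ 0 := by exact_mod_cast hk0
    have hn : ((α.num.toNat : ℕ) : ℤ) = α.num := Int.toNat_of_nonneg (Rat.num_nonneg.2 h0)
    have hn' : ((α.num.toNat : ℕ) : ℚ) = α.num := by exact_mod_cast hn
    have hα : (α.num : ℚ) = α * α.den := (Rat.mul_den_eq_num α).symm
    refine ⟨α.num.toNat * k, ?_, ?_⟩
    · rw [hk]
      apply Nat.mul_lt_mul_of_pos_right _ (Nat.pos_of_ne_zero hk0)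
      have : ((α.num.toNat : ℕ) : ℚ) < α.den := by
        rw [hn', hα]
        have : (0 : ℚ) < α.den := by exact_mod_cast α.den_pos
        nlinarith
      exact_mod_cast this
    · rw [hk]; push_cast; rw [hn', hα]; field_simp

theorem mem_farey {Q : ℕ} {α : ℚ} : α ∈ farey Q ↔ 0 ≤ α ∧ α < 1 ∧ α.den ≤ Q := by
  simp only [farey, Finset.mem_biUnion, image_div_range, Finset.mem_Icc]
  constructor
  · rintro ⟨q, ⟨h1, h2⟩, h3, h4, h5, h6⟩
    exact ⟨h3, h4, (Nat.le_of_dvd (by omega) h5).trans h2⟩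
  · rintro ⟨h1, h2, h3⟩
    exact ⟨α.den, ⟨α.den_pos, h3⟩, h1, h2, dvd_rfl, α.den_ne_zero⟩

theorem sum_range_div_eq_sum_farey {E : Type*} [AddCommMonoid E] {Q q : ℕ} (hq : q ≠ 0)
    (hqQ : q ≤ Q) (f : ℚ → E) :
    ∑ j ∈ Finset.range q, f (j / q : ℚ) = ∑ α ∈ farey Q with α.den ∣ q, f α := by
  have himg : (farey Q).filter (fun α => α.den ∣ q) =
      (Finset.range q).image (fun j : ℕ => (j / q : ℚ)) := by
    ext α
    rw [image_div_range, Finset.mem_filter, mem_farey]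
    constructor
    · rintro ⟨⟨h1, h2, h3⟩, h4⟩; exact ⟨h1, h2, h4, hq⟩
    · rintro ⟨h1, h2, h3, h4⟩
      exact ⟨⟨h1, h2, (Nat.le_of_dvd (Nat.pos_of_ne_zero hq) h3).trans hqQ⟩, h3⟩
  rw [himg, Finset.sum_image]
  intro i _ j _ hij
  have hq' : (q : ℚ) ≠ 0 := by exact_mod_cast hq
  simp only at hij
  rw [div_left_inj' hq'] at hij
  exact_mod_cast hij

theorem farey_spacing {Q : ℕ} {α β : ℚ} (hα : α ∈ farey Q) (hβ : β ∈ farey Q) (hne : α ≠ β)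
    (k : ℤ) : 1 ≤ ((Q ^ 2 : ℕ) : ℝ) * |(α : ℝ) - β + k| := by
  rw [mem_farey] at hα hβ
  obtain ⟨a0, a1, aQ⟩ := hα
  obtain ⟨b0, b1, bQ⟩ := hβ
  have hz : α - β + k ≠ 0 := by
    intro h
    have hk : (k : ℚ) = β - α := by linarith
    have h1 : (k : ℚ) < 1 := by linarith
    have h2 : (-1 : ℚ) < k := by linarith
    have h1' : k < 1 := by exact_mod_cast h1
    have h2' : -1 < k := by exact_mod_cast h2
    have : k = 0 := by omega
    subst this
    apply hne; push_cast at hk; linarith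
  have ha : (α.num : ℚ) = α * α.den := (Rat.mul_den_eq_num α).symm
  have hb : (β.num : ℚ) = β * β.den := (Rat.mul_den_eq_num β).symm
  set z : ℤ := α.num * β.den - β.num * α.den + k * α.den * β.den with hzdef
  have hze : (z : ℚ) = (α - β + k) * (α.den * β.den) := by
    rw [hzdef]; push_cast; rw [ha, hb]; ring
  have hd : (0 : ℚ) < α.den * β.den := by
    have := α.den_pos; have := β.den_pos; positivity
  have hz0 : z ≠ 0 := by
    have : (z : ℚ) ≠ 0 := by rw [hze]; exact mul_ne_zero hz hd.ne'
    exact_mod_cast this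
  have h1 : (1 : ℚ) ≤ |(z : ℚ)| := by exact_mod_cast Int.one_le_abs hz0
  rw [hze, abs_mul, abs_of_pos hd] at h1
  have h2 : ((α.den * β.den : ℕ) : ℚ) ≤ ((Q ^ 2 : ℕ) : ℚ) := by
    rw [pow_two]; exact_mod_cast Nat.mul_le_mul aQ bQ
  have h3 : (1 : ℚ) ≤ ((Q ^ 2 : ℕ) : ℚ) * |α - β + k| := by
    push_cast at h2 ⊢
    nlinarith [abs_nonneg (α - β + k)]
  exact_mod_cast h3

theorem sum_one_div_le_of_spacing {ι : Type*} (s : Finset ι) (γ : ι → ℝ) (M : ℕ)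
    (h0 : ∀ i ∈ s, 0 ≤ γ i) (h1 : ∀ i ∈ s, γ i < 1) (hM : ∀ i ∈ s, 1 ≤ M * γ i)
    (hsp : ∀ i ∈ s, ∀ j ∈ s, i ≠ j → 1 ≤ M * |γ i - γ j|) :
    ∑ i ∈ s, 1 / γ i ≤ M * ∑ k ∈ Finset.Icc 1 M, 1 / (k : ℝ) := by
  have hpos : ∀ i ∈ s, 0 < γ i := fun i hi => lt_of_le_of_ne (h0 i hi) (by
    intro h; have := hM i hi; rw [← h] at this; norm_num at this)
  have hinj : Set.InjOn (fun i => ⌊M * γ i⌋₊) s := by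
    intro i hi j hj hij
    by_contra hne
    have h2 := hsp i hi j hj hne
    have hi1 := Nat.floor_le (zero_le_one.trans (hM i hi))
    have hj1 := Nat.floor_le (zero_le_one.trans (hM j hj))
    have hi2 := Nat.lt_floor_add_one (M * γ i)
    have hj2 := Nat.lt_floor_add_one (M * γ j)
    simp only at hij
    rw [hij] at hi1 hi2
    have : (M : ℝ) * |γ i - γ j| = |M * γ i - M * γ j| := by
      rw [← mul_sub, abs_mul, Nat.abs_cast]
    rw [this] at h2
    have : |M * γ i - M * γ j| < 1 := by rw [abs_lt]; constructor <;> linarith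
    linarith
  calc ∑ i ∈ s, 1 / γ i ≤ ∑ i ∈ s, (M : ℝ) * (1 / (⌊M * γ i⌋₊ : ℝ)) := by
        refine Finset.sum_le_sum fun i hi => ?_
        have hf : 1 ≤ ⌊M * γ i⌋₊ := Nat.one_le_floor_iff _ |>.2 (hM i hi)
        have hf' : (1 : ℝ) ≤ ⌊M * γ i⌋₊ := by exact_mod_cast hf
        rw [mul_one_div, div_le_div_iff₀ (hpos i hi) (by linarith), one_mul]
        exact Nat.floor_le (zero_le_one.trans (hM i hi))
    _ = M * ∑ k ∈ s.image (fun i => ⌊M * γ i⌋₊), 1 / (k : ℝ) := by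
        rw [Finset.sum_image hinj, Finset.mul_sum]
    _ ≤ _ := by
        gcongr
        intro k hk
        obtain ⟨i, hi, rfl⟩ := Finset.mem_image.1 hk
        rw [Finset.mem_Icc]
        refine ⟨Nat.one_le_floor_iff _ |>.2 (hM i hi), ?_⟩
        apply Nat.floor_le_of_le
        have := (h1 i hi).le
        have hM0 : (0 : ℝ) ≤ M := Nat.cast_nonneg M
        nlinarith

/-- The harmonic sum `∑_{k ≤ n} 1 / k`. -/
noncomputable def harmSum (n : ℕ) : ℝ := ∑ k ∈ Finset.Icc 1 n, 1 / (k : ℝ)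

theorem harmSum_nonneg (n : ℕ) : 0 ≤ harmSum n := Finset.sum_nonneg fun _ _ => by positivity

theorem harmSum_mono {m n : ℕ} (h : m ≤ n) : harmSum m ≤ harmSum n :=
  Finset.sum_le_sum_of_subset_of_nonneg (Finset.Icc_subset_Icc le_rfl h)
    (fun _ _ _ => by positivity)

theorem harmSum_le (n : ℕ) : harmSum n ≤ 1 + Real.log n := by
  have h := harmonic_le_one_add_log n
  simpa [harmSum, harmonic_eq_sum_Icc] using h

theorem sum_one_div_fract_le {Q : ℕ} {α : ℚ} (hα : α ∈ farey Q) :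
    ∑ β ∈ (farey Q).erase α, 1 / Int.fract ((β : ℝ) - α) ≤ (Q ^ 2 : ℕ) * harmSum (Q ^ 2) := by
  refine sum_one_div_le_of_spacing _ (fun β : ℚ => Int.fract ((β : ℝ) - α)) _
    (fun _ _ => Int.fract_nonneg _) (fun _ _ => Int.fract_lt_one _) ?_ ?_
  · intro β hβ
    rw [Finset.mem_erase] at hβ
    have := farey_spacing hβ.2 hα hβ.1 (-⌊(β : ℝ) - α⌋)
    rw [← abs_of_nonneg (Int.fract_nonneg ((β : ℝ) - α)), Int.fract]
    convert this using 3; push_cast; ring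
  · intro β hβ β' hβ' hne
    rw [Finset.mem_erase] at hβ hβ'
    have := farey_spacing hβ.2 hβ'.2 hne (⌊(β' : ℝ) - α⌋ - ⌊(β : ℝ) - α⌋)
    simp only [Int.fract]
    convert this using 3; push_cast; ring

theorem sum_one_div_fract_le' {Q : ℕ} {α : ℚ} (hα : α ∈ farey Q) :
    ∑ β ∈ (farey Q).erase α, 1 / Int.fract ((α : ℝ) - β) ≤ (Q ^ 2 : ℕ) * harmSum (Q ^ 2) := by
  refine sum_one_div_le_of_spacing _ (fun β : ℚ => Int.fract ((α : ℝ) - β)) _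
    (fun _ _ => Int.fract_nonneg _) (fun _ _ => Int.fract_lt_one _) ?_ ?_
  · intro β hβ
    rw [Finset.mem_erase] at hβ
    have := farey_spacing hα hβ.2 hβ.1.symm (-⌊(α : ℝ) - β⌋)
    rw [← abs_of_nonneg (Int.fract_nonneg ((α : ℝ) - β)), Int.fract]
    convert this using 3; push_cast; ring
  · intro β hβ β' hβ' hne
    rw [Finset.mem_erase] at hβ hβ'
    have := farey_spacing hβ'.2 hβ.2 hne.symm (⌊(α : ℝ) - β'⌋ - ⌊(α : ℝ) - β⌋)
    simp only [Int.fract]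
    convert this using 3; push_cast; ring

theorem fract_sub_ne_zero {Q : ℕ} {α β : ℚ} (hα : α ∈ farey Q) (hβ : β ∈ farey Q)
    (hne : α ≠ β) : Int.fract ((α : ℝ) - β) ≠ 0 := by
  intro h
  have := farey_spacing hα hβ hne (-⌊(α : ℝ) - β⌋)
  rw [Int.fract] at h
  rw [show (α : ℝ) - β + ((-⌊(α : ℝ) - β⌋ : ℤ) : ℝ) = 0 by push_cast; linarith] at this
  norm_num at this

theorem sum_mul_mul_le_of_row_sum_le {ι : Type*} (s : Finset ι) (w : ι → ℝ) (K : ι → ι → ℝ)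
    (R : ℝ) (hK : ∀ i j, 0 ≤ K i j) (hsymm : ∀ i j, K i j = K j i)
    (hR : ∀ i ∈ s, ∑ j ∈ s, K i j ≤ R) :
    ∑ i ∈ s, ∑ j ∈ s, w i * w j * K i j ≤ R * ∑ i ∈ s, w i ^ 2 := by
  have h1 : ∑ i ∈ s, ∑ j ∈ s, w i ^ 2 * K i j ≤ R * ∑ i ∈ s, w i ^ 2 := by
    rw [Finset.mul_sum]
    refine Finset.sum_le_sum fun i hi => ?_
    rw [← Finset.mul_sum, mul_comm]
    exact mul_le_mul_of_nonneg_right (hR i hi) (sq_nonneg _)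
  have h2 : ∑ i ∈ s, ∑ j ∈ s, w j ^ 2 * K i j = ∑ i ∈ s, ∑ j ∈ s, w i ^ 2 * K i j := by
    rw [Finset.sum_comm]
    exact Finset.sum_congr rfl fun i _ => Finset.sum_congr rfl fun j _ => by rw [hsymm]
  have h3 : ∑ i ∈ s, ∑ j ∈ s, w i * w j * K i j ≤
      ∑ i ∈ s, ∑ j ∈ s, (1 / 2 * (w i ^ 2 * K i j) + 1 / 2 * (w j ^ 2 * K i j)) := by
    refine Finset.sum_le_sum fun i _ => Finset.sum_le_sum fun j _ => ?_
    nlinarith [hK i j, mul_nonneg (sq_nonneg (w i - w j)) (hK i j)]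
  simp only [Finset.sum_add_distrib] at h3
  simp only [← Finset.mul_sum _ _ (1 / 2 : ℝ)] at h3
  linarith

/-- A majorant of the exponential sums with frequency `α - β` over subintervals of `(N, 2N]`. -/
noncomputable def fareyKernel (N : ℕ) (α β : ℚ) : ℝ :=
  if α = β then N else 1 / Int.fract ((β : ℝ) - α) + 1 / Int.fract ((α : ℝ) - β)

theorem fareyKernel_nonneg (N : ℕ) (α β : ℚ) : 0 ≤ fareyKernel N α β := by
  unfold fareyKernel
  split_ifs
  · positivity
  · exact add_nonneg (one_div_nonneg.2 (Int.fract_nonneg _)) (one_div_nonneg.2 (Int.fract_nonneg _))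

theorem fareyKernel_comm (N : ℕ) (α β : ℚ) : fareyKernel N α β = fareyKernel N β α := by
  unfold fareyKernel
  simp only [eq_comm (a := α), add_comm]

theorem sum_fareyKernel_le {Q N : ℕ} {α : ℚ} (hα : α ∈ farey Q) :
    ∑ β ∈ farey Q, fareyKernel N α β ≤ N + 2 * ((Q ^ 2 : ℕ) * harmSum (Q ^ 2)) := by
  rw [← Finset.add_sum_erase _ _ hα]
  have h : ∑ β ∈ (farey Q).erase α, fareyKernel N α β =
      ∑ β ∈ (farey Q).erase α,
        (1 / Int.fract ((β : ℝ) - α) + 1 / Int.fract ((α : ℝ) - β)) := by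
    refine Finset.sum_congr rfl fun β hβ => ?_
    rw [fareyKernel, if_neg (Finset.ne_of_mem_erase hβ).symm]
  rw [h, Finset.sum_add_distrib, fareyKernel, if_pos rfl]
  linarith [sum_one_div_fract_le hα, sum_one_div_fract_le' hα]

theorem norm_sum_eChar_le_fareyKernel {Q N : ℕ} {α β : ℚ} (hα : α ∈ farey Q) (hβ : β ∈ farey Q)
    (k : ℕ) :
    ‖∑ x ∈ Finset.Ioc N (2 * N) with k ≤ x, eChar (x * (α - β))‖ ≤ fareyKernel N α β := by
  unfold fareyKernel
  split_ifs with h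
  · subst h
    simp only [sub_self, mul_zero, eChar_zero, Finset.sum_const, nsmul_eq_mul, mul_one,
      Complex.norm_natCast]
    have := Finset.card_filter_le (Finset.Ioc N (2 * N)) (fun x => k ≤ x)
    rw [Nat.card_Ioc] at this
    exact_mod_cast this.trans (by omega)
  · have hf := fract_sub_ne_zero hα hβ h
    have hset : (Finset.Ioc N (2 * N)).filter (fun x => k ≤ x) =
        Finset.Ico (max (N + 1) k) (2 * N + 1) := by
      ext x; simp only [Finset.mem_filter, Finset.mem_Ioc, Finset.mem_Ico, max_le_iff]; omega
    rw [hset]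
    refine (norm_sum_Ico_eChar_le _ hf _ _).trans (le_of_eq ?_)
    rw [← Int.fract_neg hf, neg_sub, add_comm]

/-- The large sieve inequality for Farey fractions, where each term may carry its own lower
cutoff for the summation variable. -/
theorem large_sieve_cutoff (Q N : ℕ) (I : Finset ℕ) (k : ℕ → ℕ) (c : ℚ → ℕ → ℂ) :
    ∑ x ∈ Finset.Ioc N (2 * N),
      ‖∑ α ∈ farey Q, ∑ q ∈ I, c α q * (if k q ≤ x then eChar (x * α) else 0)‖ ^ 2 ≤
      (N + 2 * ((Q ^ 2 : ℕ) * harmSum (Q ^ 2))) * ∑ α ∈ farey Q, (∑ q ∈ I, ‖c α q‖) ^ 2 := by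
  set u : ℚ × ℕ → ℕ → ℂ := fun p x => c p.1 p.2 * (if k p.2 ≤ x then eChar (x * p.1) else 0)
    with hu
  set P := farey Q ×ˢ I with hP
  have hpair : ∀ p ∈ P, ∀ p' ∈ P,
      ‖∑ x ∈ Finset.Ioc N (2 * N), u p x * (starRingEnd ℂ) (u p' x)‖ ≤
        ‖c p.1 p.2‖ * ‖c p'.1 p'.2‖ * fareyKernel N p.1 p'.1 := by
    intro p hp p' hp'
    rw [hP, Finset.mem_product] at hp hp'
    have h : ∀ x : ℕ, u p x * (starRingEnd ℂ) (u p' x) =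
        c p.1 p.2 * (starRingEnd ℂ) (c p'.1 p'.2) *
          (if max (k p.2) (k p'.2) ≤ x then eChar (x * (p.1 - p'.1)) else 0) := by
      intro x
      simp only [hu, map_mul, max_le_iff]
      by_cases h1 : k p.2 ≤ x <;> by_cases h2 : k p'.2 ≤ x <;> simp only [h1, h2, if_true, if_false,
        and_true, and_false, and_self, map_zero, mul_zero, zero_mul]
      rw [conj_eChar, mul_sub, sub_eq_add_neg, eChar_add]; ring
    simp only [h]
    rw [← Finset.mul_sum, norm_mul, norm_mul, Complex.norm_conj, ← Finset.sum_filter]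
    gcongr
    exact norm_sum_eChar_le_fareyKernel hp.1 hp'.1 _
  have hsq : ((∑ x ∈ Finset.Ioc N (2 * N),
      ‖∑ α ∈ farey Q, ∑ q ∈ I, c α q * (if k q ≤ x then eChar (x * α) else 0)‖ ^ 2 : ℝ) : ℂ) =
      ∑ p ∈ P, ∑ p' ∈ P, ∑ x ∈ Finset.Ioc N (2 * N), u p x * (starRingEnd ℂ) (u p' x) := by
    push_cast
    have : ∀ x : ℕ, ((‖∑ α ∈ farey Q, ∑ q ∈ I,
        c α q * (if k q ≤ x then eChar (x * α) else 0)‖ : ℂ)) ^ 2 =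
        ∑ p ∈ P, ∑ p' ∈ P, u p x * (starRingEnd ℂ) (u p' x) := by
      intro x
      rw [← Complex.mul_conj', ← Finset.sum_product', map_sum, Finset.sum_mul_sum]
    simp only [this]
    rw [Finset.sum_comm]
    exact Finset.sum_congr rfl fun p _ => Finset.sum_comm
  have hnn : 0 ≤ ∑ x ∈ Finset.Ioc N (2 * N),
      ‖∑ α ∈ farey Q, ∑ q ∈ I, c α q * (if k q ≤ x then eChar (x * α) else 0)‖ ^ 2 :=
    Finset.sum_nonneg fun _ _ => by positivity
  rw [← abs_of_nonneg hnn, ← Real.norm_eq_abs, ← Complex.norm_real, hsq]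
  calc _ ≤ ∑ p ∈ P, ∑ p' ∈ P,
        ‖c p.1 p.2‖ * ‖c p'.1 p'.2‖ * fareyKernel N p.1 p'.1 :=
        (norm_sum_le _ _).trans (Finset.sum_le_sum fun p hp =>
          (norm_sum_le _ _).trans (Finset.sum_le_sum fun p' hp' => hpair p hp p' hp'))
    _ = ∑ α ∈ farey Q, ∑ β ∈ farey Q,
        (∑ q ∈ I, ‖c α q‖) * (∑ q ∈ I, ‖c β q‖) * fareyKernel N α β := by
        rw [hP, Finset.sum_product]
        refine Finset.sum_congr rfl fun α _ => ?_
        simp only [Finset.sum_product]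
        rw [Finset.sum_comm]
        refine Finset.sum_congr rfl fun β _ => ?_
        rw [Finset.sum_mul_sum, Finset.sum_mul]
        exact Finset.sum_congr rfl fun q _ => (Finset.sum_mul _ _ _).symm
    _ ≤ _ := sum_mul_mul_le_of_row_sum_le _ _ _ _ (fareyKernel_nonneg N) (fareyKernel_comm N)
        fun α hα => sum_fareyKernel_le hα

/-- The Fourier coefficients of the symmetric difference of two adjacent intervals. -/
noncomputable def oddSum (H : ℕ) (θ : ℝ) : ℂ :=
  ∑ h ∈ Finset.Icc 1 H, (eChar (h * θ) - eChar (h * -θ))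

theorem oddSum_zero (H : ℕ) : oddSum H 0 = 0 := by simp [oddSum]

theorem norm_oddSum_sq_le (H : ℕ) {θ : ℝ} (h0 : 0 < θ) (h1 : θ < 1) :
    ‖oddSum H θ‖ ^ 2 ≤ 4 * H * (1 / θ + 1 / (1 - θ)) := by
  have b1 : ‖oddSum H θ‖ ≤ 2 * H := by
    refine (norm_sum_le _ _).trans ?_
    calc _ ≤ ∑ h ∈ Finset.Icc 1 H, (2 : ℝ) := Finset.sum_le_sum fun h _ => by
          refine (norm_sub_le _ _).trans ?_
          rw [norm_eChar, norm_eChar]; norm_num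
      _ = 2 * H := by simp [mul_comm]
  have f1 : Int.fract θ = θ := Int.fract_eq_self.2 ⟨h0.le, h1⟩
  have f2 : Int.fract (-θ) = 1 - θ := by rw [Int.fract_neg (by rw [f1]; exact h0.ne'), f1]
  have b2 : ‖oddSum H θ‖ ≤ 2 * (1 / θ + 1 / (1 - θ)) := by
    have hIcc : Finset.Icc 1 H = Finset.Ico 1 (H + 1) := by
      ext; simp only [Finset.mem_Icc, Finset.mem_Ico]; omega
    rw [oddSum, Finset.sum_sub_distrib, hIcc]
    refine (norm_sub_le _ _).trans ?_
    have e1 := norm_sum_Ico_eChar_le θ (by rw [f1]; exact h0.ne') 1 (H + 1)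
    have e2 := norm_sum_Ico_eChar_le (-θ) (by rw [f2]; linarith) 1 (H + 1)
    rw [f1] at e1
    rw [f2, sub_sub_cancel] at e2
    linarith
  nlinarith [norm_nonneg (oddSum H θ), mul_le_mul b1 b2 (norm_nonneg _) (by positivity)]

theorem sum_one_div_num_den_le (Q : ℕ) (s : Finset ℚ) (f : ℚ → ℕ × ℕ) (hf : Set.InjOn f s)
    (hmem : ∀ α ∈ s, f α ∈ Finset.Icc 1 Q ×ˢ Finset.Icc 1 Q) :
    ∑ α ∈ s, 1 / (((f α).1 : ℝ) * (f α).2) ≤ harmSum Q ^ 2 := by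
  have h : harmSum Q ^ 2 = ∑ p ∈ Finset.Icc 1 Q ×ˢ Finset.Icc 1 Q, 1 / ((p.1 : ℝ) * p.2) := by
    rw [pow_two, harmSum, Finset.sum_mul_sum, Finset.sum_product]
    exact Finset.sum_congr rfl fun a _ => Finset.sum_congr rfl fun b _ => by
      rw [one_div_mul_one_div]
  rw [h, ← Finset.sum_image (f := fun p : ℕ × ℕ => 1 / ((p.1 : ℝ) * p.2)) hf]
  exact Finset.sum_le_sum_of_subset_of_nonneg (Finset.image_subset_iff.2 hmem)
    (fun _ _ _ => by positivity)

theorem sum_norm_oddSum_sq_le (Q H : ℕ) :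
    ∑ α ∈ farey Q, ‖oddSum H α‖ ^ 2 / (α.den : ℝ) ^ 2 ≤ 8 * H * harmSum Q ^ 2 := by
  set s := (farey Q).filter (fun α => α ≠ 0) with hs
  have hprop : ∀ α ∈ s, 0 < α ∧ α < 1 ∧ α.den ≤ Q ∧ 0 < α.num ∧ α.num < α.den := by
    intro α hα
    rw [hs, Finset.mem_filter, mem_farey] at hα
    obtain ⟨⟨h0, h1, h2⟩, h3⟩ := hα
    have hp : 0 < α := lt_of_le_of_ne h0 (Ne.symm h3)
    exact ⟨hp, h1, h2, Rat.num_pos.2 hp, Rat.num_lt_denom_iff.2 h1⟩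
  have hstep : ∀ α ∈ s, ‖oddSum H α‖ ^ 2 / (α.den : ℝ) ^ 2 ≤
      4 * H * (1 / ((α.num.toNat : ℝ) * α.den)) +
        4 * H * (1 / (((α.den - α.num.toNat : ℕ) : ℝ) * α.den)) := by
    intro α hα
    obtain ⟨h0, h1, h2, h3, h4⟩ := hprop α hα
    have hd : (0 : ℝ) < α.den := by exact_mod_cast α.den_pos
    have hnz : ((α.num.toNat : ℕ) : ℤ) = α.num := Int.toNat_of_nonneg h3.le
    have hq : ((α.num.toNat : ℕ) : ℚ) = α * α.den := by
      rw [Rat.mul_den_eq_num]; exact_mod_cast hnz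
    have hr : ((α.num.toNat : ℕ) : ℝ) = α * α.den := by exact_mod_cast hq
    have hle : α.num.toNat ≤ α.den := by omega
    have h0' : (0 : ℝ) < α := by exact_mod_cast h0
    have h1' : (α : ℝ) < 1 := by exact_mod_cast h1
    rw [Nat.cast_sub hle, hr, div_le_iff₀ (by positivity)]
    refine (norm_oddSum_sq_le H h0' h1').trans (le_of_eq ?_)
    have : (1 - α : ℝ) ≠ 0 := by linarith
    rw [show (α.den : ℝ) - α * α.den = (1 - α) * α.den by ring]
    field_simp
  have hinj1 : Set.InjOn (fun α : ℚ => (α.num.toNat, α.den)) s := by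
    intro α hα β hβ h
    have ha := (hprop α hα).2.2.2.1
    have hb := (hprop β hβ).2.2.2.1
    simp only [Prod.mk.injEq] at h
    exact Rat.ext (by omega) h.2
  have hinj2 : Set.InjOn (fun α : ℚ => (α.den - α.num.toNat, α.den)) s := by
    intro α hα β hβ h
    have ha := (hprop α hα).2.2.2
    have hb := (hprop β hβ).2.2.2
    simp only [Prod.mk.injEq] at h
    exact Rat.ext (by omega) h.2
  have b1 := sum_one_div_num_den_le Q s _ hinj1 (fun α hα => by
    have := hprop α hα
    simp only [Finset.mem_product, Finset.mem_Icc]; omega)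
  have b2 := sum_one_div_num_den_le Q s _ hinj2 (fun α hα => by
    have := hprop α hα
    simp only [Finset.mem_product, Finset.mem_Icc]; omega)
  have hfilter : ∑ α ∈ farey Q, ‖oddSum H α‖ ^ 2 / (α.den : ℝ) ^ 2 =
      ∑ α ∈ s, ‖oddSum H α‖ ^ 2 / (α.den : ℝ) ^ 2 := by
    rw [hs, Finset.sum_filter]
    refine Finset.sum_congr rfl fun α _ => ?_
    split_ifs with h
    · rfl
    · rw [not_ne_iff] at h; subst h; simp [oddSum_zero]
  rw [hfilter]
  refine (Finset.sum_le_sum hstep).trans ?_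
  rw [Finset.sum_add_distrib, ← Finset.mul_sum, ← Finset.mul_sum]
  simp only at b1 b2
  have hH : (0 : ℝ) ≤ 4 * H := by positivity
  nlinarith [mul_le_mul_of_nonneg_left b1 hH, mul_le_mul_of_nonneg_left b2 hH]

/-- The number of factorizations `q = u v` weighted by `1 + [v ≤ T] + [u ≤ T and v ≤ T]`. -/
noncomputable def pairWeight (T q : ℕ) : ℝ :=
  ∑ u ∈ q.divisorsAntidiagonal,
    (1 + (if u.2 ≤ T then 1 else 0) + (if u.1 ≤ T ∧ u.2 ≤ T then 1 else 0))

theorem pairWeight_nonneg (T q : ℕ) : 0 ≤ pairWeight T q :=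
  Finset.sum_nonneg fun u _ => by positivity

theorem pairWeight_le (T q : ℕ) : pairWeight T q ≤ 3 * q.divisors.card := by
  have hc : q.divisorsAntidiagonal.card = q.divisors.card := by
    rw [← Nat.map_div_right_divisors, Finset.card_map]
  rw [← hc]
  calc pairWeight T q ≤ ∑ u ∈ q.divisorsAntidiagonal, (3 : ℝ) :=
        Finset.sum_le_sum fun u _ => by split_ifs <;> norm_num
    _ = _ := by simp [mul_comm]

theorem d3_eq_sum_pairWeight {T n R : ℕ} (hn : T ^ 3 < n) (hR : n ≤ R) :
    (d3 n : ℝ) = ∑ q ∈ Finset.Icc 1 R,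
      if q * (T + 1) ≤ n ∧ q ∣ n then pairWeight T q else 0 := by
  set P := (Finset.Icc 1 n ×ˢ Finset.Icc 1 n ×ˢ Finset.Icc 1 n).filter
    (fun t => t.1 * t.2.1 * t.2.2 = n) with hP
  have hmem : ∀ a b c : ℕ, (a, b, c) ∈ P ↔ a * b * c = n := by
    intro a b c
    rw [hP, Finset.mem_filter]
    simp only [Finset.mem_product, Finset.mem_Icc]
    refine ⟨fun h => h.2, fun h => ⟨?_, h⟩⟩
    have h0 : a * b * c ≠ 0 := by omega
    have ha : a ≠ 0 := by rintro rfl; simp at h0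
    have hb : b ≠ 0 := by rintro rfl; simp at h0
    have hc : c ≠ 0 := by rintro rfl; simp at h0
    have hn0 : 0 < n := by omega
    have da : a ∣ n := ⟨b * c, by rw [← h]; ring⟩
    have db : b ∣ n := ⟨a * c, by rw [← h]; ring⟩
    have dc : c ∣ n := ⟨a * b, by rw [← h]; ring⟩
    have := Nat.le_of_dvd hn0 da
    have := Nat.le_of_dvd hn0 db
    have := Nat.le_of_dvd hn0 dc
    omega
  have h1 : (d3 n : ℝ) = ∑ t ∈ P, (1 : ℝ) := by simp [d3, hP]
  have h2 : ∑ t ∈ P, (1 : ℝ) = ∑ t ∈ P, ((if T < t.2.2 then 1 else 0) +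
      (if T < t.2.1 ∧ t.2.2 ≤ T then 1 else 0) +
      (if T < t.1 ∧ t.2.1 ≤ T ∧ t.2.2 ≤ T then 1 else 0)) := by
    refine Finset.sum_congr rfl ?_
    rintro ⟨a, b, c⟩ ht
    rw [hmem] at ht
    simp only
    by_cases hc : T < c
    · simp [hc, not_le.2 hc]
    by_cases hb : T < b
    · simp [hb, hc, not_le.2 hb, not_lt.1 hc]
    by_cases ha : T < a
    · simp [ha, hb, hc, not_lt.1 hb, not_lt.1 hc]
    · exfalso
      have := Nat.mul_le_mul (Nat.mul_le_mul (not_lt.1 ha) (not_lt.1 hb)) (not_lt.1 hc)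
      rw [ht] at this
      have : T * T * T = T ^ 3 := by ring
      omega
  have h3 : ∑ t ∈ P, (if T < t.2.1 ∧ t.2.2 ≤ T then (1 : ℝ) else 0) =
      ∑ t ∈ P, if T < t.2.2 ∧ t.2.1 ≤ T then 1 else 0 := by
    refine Finset.sum_nbij' (fun t => (t.1, t.2.2, t.2.1)) (fun t => (t.1, t.2.2, t.2.1))
      ?_ ?_ ?_ ?_ ?_
    · rintro ⟨a, b, c⟩ h; rw [hmem] at h ⊢; rw [← h]; ring
    · rintro ⟨a, b, c⟩ h; rw [hmem] at h ⊢; rw [← h]; ring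
    · intros; rfl
    · intros; rfl
    · intros; rfl
  have h4 : ∑ t ∈ P, (if T < t.1 ∧ t.2.1 ≤ T ∧ t.2.2 ≤ T then (1 : ℝ) else 0) =
      ∑ t ∈ P, if T < t.2.2 ∧ t.1 ≤ T ∧ t.2.1 ≤ T then 1 else 0 := by
    refine Finset.sum_nbij' (fun t => (t.2.1, t.2.2, t.1)) (fun t => (t.2.2, t.1, t.2.1))
      ?_ ?_ ?_ ?_ ?_
    · rintro ⟨a, b, c⟩ h; rw [hmem] at h ⊢; rw [← h]; ring
    · rintro ⟨a, b, c⟩ h; rw [hmem] at h ⊢; rw [← h]; ring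
    · intros; rfl
    · intros; rfl
    · intros; rfl
  have h5 : ∑ t ∈ P, (1 : ℝ) = ∑ t ∈ P with T < t.2.2,
      (1 + (if t.2.1 ≤ T then 1 else 0) + (if t.1 ≤ T ∧ t.2.1 ≤ T then 1 else 0) : ℝ) := by
    rw [h2, Finset.sum_add_distrib, Finset.sum_add_distrib, h3, h4, ← Finset.sum_add_distrib,
      ← Finset.sum_add_distrib, Finset.sum_filter (fun t : ℕ × ℕ × ℕ => T < t.2.2)]
    refine Finset.sum_congr rfl fun t _ => ?_
    by_cases h : T < t.2.2 <;> simp [h]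
  rw [h1, h5, ← Finset.sum_filter]
  simp only [pairWeight]
  rw [Finset.sum_sigma']
  refine Finset.sum_bij' (fun t _ => (⟨t.1 * t.2.1, (t.1, t.2.1)⟩ : (_ : ℕ) × ℕ × ℕ))
    (fun s _ => (s.2.1, s.2.2, n / s.1)) ?_ ?_ ?_ ?_ ?_
  · rintro ⟨a, b, c⟩ h
    rw [Finset.mem_filter, hmem] at h
    obtain ⟨h, hc⟩ := h
    simp only at hc
    have h0 : 0 < a * b * c := by omega
    have hab : 0 < a * b := Nat.pos_of_mul_pos_right h0
    simp only [Finset.mem_sigma, Finset.mem_filter, Finset.mem_Icc,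
      Nat.mem_divisorsAntidiagonal, true_and]
    have hle : a * b * (T + 1) ≤ a * b * c := Nat.mul_le_mul_left _ hc
    have hle2 : a * b ≤ a * b * c := Nat.le_mul_of_pos_right _ (by omega)
    exact ⟨⟨⟨hab, by omega⟩, by omega, ⟨c, h.symm⟩⟩, by omega⟩
  · rintro ⟨q, a, b⟩ h
    simp only [Finset.mem_sigma, Finset.mem_filter, Finset.mem_Icc,
      Nat.mem_divisorsAntidiagonal] at h
    obtain ⟨⟨⟨hq1, hq2⟩, hqT, hqn⟩, hab, -⟩ := h
    rw [Finset.mem_filter, hmem]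
    simp only
    refine ⟨by rw [hab]; exact Nat.mul_div_cancel' hqn, ?_⟩
    rw [Nat.lt_iff_add_one_le, Nat.le_div_iff_mul_le (by omega), mul_comm]
    exact hqT
  · rintro ⟨a, b, c⟩ h
    rw [Finset.mem_filter, hmem] at h
    obtain ⟨h, hc⟩ := h
    have h0 : 0 < a * b * c := by omega
    have hab : 0 < a * b := Nat.pos_of_mul_pos_right h0
    simp only [Prod.mk.injEq, true_and]
    rw [← h]; exact Nat.mul_div_cancel_left _ hab
  · rintro ⟨q, a, b⟩ h
    simp only [Finset.mem_sigma, Nat.mem_divisorsAntidiagonal] at h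
    obtain ⟨-, hab, -⟩ := h
    subst hab; rfl
  · rintro ⟨a, b, c⟩ h; rfl

theorem sum_Icc_mul_sgn (f : ℕ → ℝ) {x H : ℕ} (hx : H ≤ x) :
    ∑ n ∈ Finset.Icc (x - H) (x + H), f n * sgn ((n : ℤ) - (x : ℤ)) =
      ∑ h ∈ Finset.Icc 1 H, (f (x + h) - f (x - h)) := by
  have h1 : Finset.Icc (x - H) (x + H) =
      ((Finset.Icc 1 H).image (fun h => x + h) ∪ (Finset.Icc 1 H).image (fun h => x - h)) ∪ {x} := by
    ext n
    simp only [Finset.mem_union, Finset.mem_image, Finset.mem_Icc, Finset.mem_singleton]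
    constructor
    · rintro ⟨h2, h3⟩
      rcases lt_trichotomy n x with h | h | h
      · exact Or.inl (Or.inr ⟨x - n, by omega, by omega⟩)
      · exact Or.inr h
      · exact Or.inl (Or.inl ⟨n - x, by omega, by omega⟩)
    · rintro ((⟨h, h2, rfl⟩ | ⟨h, h2, rfl⟩) | rfl) <;> omega
  have hd1 : Disjoint ((Finset.Icc 1 H).image (fun h => x + h))
      ((Finset.Icc 1 H).image (fun h => x - h)) := by
    rw [Finset.disjoint_left]
    simp only [Finset.mem_image, Finset.mem_Icc]
    rintro n ⟨h, h2, rfl⟩ ⟨h', h2', h3⟩; omega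
  have hd2 : Disjoint ((Finset.Icc 1 H).image (fun h => x + h) ∪
      (Finset.Icc 1 H).image (fun h => x - h)) {x} := by
    rw [Finset.disjoint_singleton_right]
    simp only [Finset.mem_union, Finset.mem_image, Finset.mem_Icc]
    rintro (⟨h, h2, h3⟩ | ⟨h, h2, h3⟩) <;> omega
  rw [h1, Finset.sum_union hd2, Finset.sum_union hd1, Finset.sum_image, Finset.sum_image,
    Finset.sum_singleton, Finset.sum_sub_distrib]
  · have e1 : ∀ h ∈ Finset.Icc 1 H, f (x + h) * sgn (((x + h : ℕ) : ℤ) - (x : ℤ)) = f (x + h) := by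
      intro h hh
      rw [Finset.mem_Icc] at hh
      rw [sgn, if_pos (by push_cast; omega), mul_one]
    have e2 : ∀ h ∈ Finset.Icc 1 H,
        f (x - h) * sgn (((x - h : ℕ) : ℤ) - (x : ℤ)) = - f (x - h) := by
      intro h hh
      rw [Finset.mem_Icc] at hh
      rw [sgn, if_neg (by omega), if_pos (by omega), mul_neg_one]
    rw [Finset.sum_congr rfl e1, Finset.sum_congr rfl e2, Finset.sum_neg_distrib]
    simp [sgn, sub_eq_add_neg]
  · intro a ha b hb hab
    simp only [Finset.coe_Icc, Set.mem_Icc] at ha hb hab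
    omega
  · intro a ha b hb hab
    simp only at hab
    omega

/-- The number of multiples of `q` in `(x, x + H]` minus the number of those in `[x - H, x)`. -/
noncomputable def multDiff (q x H : ℕ) : ℝ :=
  ∑ h ∈ Finset.Icc 1 H, ((if q ∣ x + h then 1 else 0) - (if q ∣ x - h then 1 else 0))

theorem card_filter_dvd_add_le_one {q x H : ℕ} (hq : H < q) :
    ((Finset.Icc 1 H).filter (fun h => q ∣ x + h)).card ≤ 1 := by
  rw [Finset.card_le_one]
  have key : ∀ a b : ℕ, 1 ≤ a → b ≤ H → a ≤ b → q ∣ x + a → q ∣ x + b → a = b := by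
    intro a b ha hb hab h1 h2
    have h3 := Nat.dvd_sub h2 h1
    have h4 := Nat.eq_zero_of_dvd_of_lt h3 (by omega)
    omega
  intro a ha b hb
  simp only [Finset.mem_filter, Finset.mem_Icc] at ha hb
  rcases le_total a b with h | h
  · exact key a b ha.1.1 hb.1.2 h ha.2 hb.2
  · exact (key b a hb.1.1 ha.1.2 h hb.2 ha.2).symm

theorem card_filter_dvd_sub_le_one {q x H : ℕ} (hq : H < q) (hx : H ≤ x) :
    ((Finset.Icc 1 H).filter (fun h => q ∣ x - h)).card ≤ 1 := by
  rw [Finset.card_le_one]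
  have key : ∀ a b : ℕ, 1 ≤ a → b ≤ H → a ≤ b → q ∣ x - a → q ∣ x - b → a = b := by
    intro a b ha hb hab h1 h2
    have h3 := Nat.dvd_sub h1 h2
    have h4 := Nat.eq_zero_of_dvd_of_lt h3 (by omega)
    omega
  intro a ha b hb
  simp only [Finset.mem_filter, Finset.mem_Icc] at ha hb
  rcases le_total a b with h | h
  · exact key a b ha.1.1 hb.1.2 h ha.2 hb.2
  · exact (key b a hb.1.1 ha.1.2 h hb.2 ha.2).symm

theorem card_filter_mul_mem_le (R D x H : ℕ) (hD : 0 < D) (hx : H ≤ x) :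
    (((Finset.Icc 1 R).filter (fun q => x - H < q * D ∧ q * D ≤ x + H)).card : ℝ) ≤
      2 * H / D + 1 := by
  have hsub : (Finset.Icc 1 R).filter (fun q => x - H < q * D ∧ q * D ≤ x + H) ⊆
      Finset.Ioc ((x - H) / D) ((x + H) / D) := by
    intro q hq
    simp only [Finset.mem_filter, Finset.mem_Ioc] at hq ⊢
    exact ⟨(Nat.div_lt_iff_lt_mul hD).2 hq.2.1, (Nat.le_div_iff_mul_le hD).2 hq.2.2⟩
  have h1 := Finset.card_le_card hsub
  rw [Nat.card_Ioc] at h1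
  have h2 : ((x + H) / D - (x - H) / D) * D ≤ 2 * H + D := by
    have a1 := Nat.div_add_mod (x + H) D
    have a2 := Nat.div_add_mod (x - H) D
    have a3 := Nat.mod_lt (x - H) hD
    rw [Nat.sub_mul, mul_comm, mul_comm ((x - H) / D)]
    omega
  have h3 := (Nat.mul_le_mul_right D h1).trans h2
  have hD' : (0 : ℝ) < D := by exact_mod_cast hD
  rw [div_add_one hD'.ne', le_div_iff₀ hD']
  exact_mod_cast h3

/-- Up to boundary terms, the odd short sum of `d₃` is a combination of the differences
`multDiff`. -/
theorem abs_oddSum_d3_sub_le {T x H R : ℕ} {B : ℝ} (hxH : H ≤ x) (hT : T ^ 3 < x - H)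
    (hR : x + H ≤ R) (hB : ∀ q ∈ Finset.Icc 1 R, pairWeight T q ≤ B)
    (hq : H * (T + 1) ≤ x - H) :
    |∑ n ∈ Finset.Icc (x - H) (x + H), (d3 n : ℝ) * sgn ((n : ℤ) - (x : ℤ)) -
      ∑ q ∈ Finset.Icc 1 R, (if q * (T + 1) ≤ x then pairWeight T q * multDiff q x H else 0)| ≤
      2 * B * (2 * H / ((T + 1 : ℕ) : ℝ) + 1) := by
  rw [sum_Icc_mul_sgn (fun n => (d3 n : ℝ)) hxH]
  have e1 : ∑ h ∈ Finset.Icc 1 H, ((d3 (x + h) : ℝ) - d3 (x - h)) =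
      ∑ q ∈ Finset.Icc 1 R, pairWeight T q * ∑ h ∈ Finset.Icc 1 H,
        ((if q * (T + 1) ≤ x + h ∧ q ∣ x + h then 1 else 0) -
          (if q * (T + 1) ≤ x - h ∧ q ∣ x - h then 1 else 0)) := by
    simp only [Finset.mul_sum]
    rw [Finset.sum_comm]
    refine Finset.sum_congr rfl fun h hh => ?_
    rw [Finset.mem_Icc] at hh
    rw [d3_eq_sum_pairWeight (T := T) (R := R) (by omega) (by omega),
      d3_eq_sum_pairWeight (T := T) (R := R) (by omega) (by omega), ← Finset.sum_sub_distrib]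
    refine Finset.sum_congr rfl fun q _ => ?_
    rw [mul_sub, mul_ite, mul_ite, mul_one, mul_zero]
  rw [e1, ← Finset.sum_sub_distrib]
  have hterm : ∀ q ∈ Finset.Icc 1 R, |(pairWeight T q * ∑ h ∈ Finset.Icc 1 H,
        ((if q * (T + 1) ≤ x + h ∧ q ∣ x + h then (1 : ℝ) else 0) -
          (if q * (T + 1) ≤ x - h ∧ q ∣ x - h then 1 else 0))) -
        (if q * (T + 1) ≤ x then pairWeight T q * multDiff q x H else 0)| ≤
      if x - H < q * (T + 1) ∧ q * (T + 1) ≤ x + H then 2 * B else 0 := by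
    intro q hqR
    have hw := pairWeight_nonneg T q
    have hsplit : (if q * (T + 1) ≤ x then pairWeight T q * multDiff q x H else 0) =
        pairWeight T q * ∑ h ∈ Finset.Icc 1 H,
          ((if q * (T + 1) ≤ x ∧ q ∣ x + h then 1 else 0) -
            (if q * (T + 1) ≤ x ∧ q ∣ x - h then 1 else 0)) := by
      by_cases h : q * (T + 1) ≤ x <;> simp [h, multDiff]
    rw [hsplit, ← mul_sub, ← Finset.sum_sub_distrib, abs_mul, abs_of_nonneg hw]
    by_cases hin : x - H < q * (T + 1) ∧ q * (T + 1) ≤ x + H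
    · rw [if_pos hin]
      have hHq : H < q := by
        by_contra hcon
        have := Nat.mul_le_mul_right (T + 1) (not_lt.1 hcon)
        omega
      have c1 : ((((Finset.Icc 1 H).filter (fun h => q ∣ x + h)).card : ℕ) : ℝ) ≤ 1 := by
        exact_mod_cast card_filter_dvd_add_le_one hHq
      have c2 : ((((Finset.Icc 1 H).filter (fun h => q ∣ x - h)).card : ℕ) : ℝ) ≤ 1 := by
        exact_mod_cast card_filter_dvd_sub_le_one hHq hxH
      have hsum : |∑ h ∈ Finset.Icc 1 H,
          ((if q * (T + 1) ≤ x + h ∧ q ∣ x + h then (1 : ℝ) else 0) -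
            (if q * (T + 1) ≤ x - h ∧ q ∣ x - h then 1 else 0) -
            ((if q * (T + 1) ≤ x ∧ q ∣ x + h then 1 else 0) -
            (if q * (T + 1) ≤ x ∧ q ∣ x - h then 1 else 0)))| ≤ 2 := by
        calc _ ≤ ∑ h ∈ Finset.Icc 1 H, ((if q ∣ x + h then (1 : ℝ) else 0) +
              (if q ∣ x - h then 1 else 0)) := by
              refine (Finset.abs_sum_le_sum_abs _ _).trans (Finset.sum_le_sum fun h _ => ?_)
              by_cases a1 : q ∣ x + h <;> by_cases a2 : q ∣ x - h <;>
                by_cases a3 : q * (T + 1) ≤ x + h <;> by_cases a4 : q * (T + 1) ≤ x - h <;>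
                by_cases a5 : q * (T + 1) ≤ x <;>
                simp only [a1, a2, a3, a4, a5, and_true, and_false, if_true, if_false] <;> norm_num
          _ ≤ 2 := by
              rw [Finset.sum_add_distrib, Finset.sum_boole, Finset.sum_boole]
              linarith
      rw [mul_comm 2 B]
      exact mul_le_mul (hB q hqR) hsum (abs_nonneg _) (hw.trans (hB q hqR))
    · rw [if_neg hin]
      have : ∀ h ∈ Finset.Icc 1 H,
          ((if q * (T + 1) ≤ x + h ∧ q ∣ x + h then (1 : ℝ) else 0) -
            (if q * (T + 1) ≤ x - h ∧ q ∣ x - h then 1 else 0) -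
            ((if q * (T + 1) ≤ x ∧ q ∣ x + h then 1 else 0) -
            (if q * (T + 1) ≤ x ∧ q ∣ x - h then 1 else 0))) = 0 := by
        intro h hh
        rw [Finset.mem_Icc] at hh
        by_cases hle : q * (T + 1) ≤ x - H
        · have a1 : q * (T + 1) ≤ x + h := by omega
          have a2 : q * (T + 1) ≤ x - h := by omega
          have a3 : q * (T + 1) ≤ x := by omega
          simp [a1, a2, a3]
        · have a1 : ¬ q * (T + 1) ≤ x + h := by omega
          have a2 : ¬ q * (T + 1) ≤ x - h := by omega
          have a3 : ¬ q * (T + 1) ≤ x := by omega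
          simp [a1, a2, a3]
      rw [Finset.sum_eq_zero this]; simp
  refine (Finset.abs_sum_le_sum_abs _ _).trans ((Finset.sum_le_sum hterm).trans ?_)
  rw [← Finset.sum_filter, Finset.sum_const, nsmul_eq_mul, mul_comm]
  have hB0 : 0 ≤ 2 * B := by
    have := hB 1 (Finset.mem_Icc.2 ⟨le_rfl, by omega⟩)
    linarith [pairWeight_nonneg T 1]
  exact mul_le_mul_of_nonneg_left (card_filter_mul_mem_le R (T + 1) x H (by omega) hxH) hB0

theorem ofReal_multDiff_eq {Q q x H : ℕ} (hq : q ∈ Finset.Icc 1 Q) (hx : H ≤ x) :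
    (multDiff q x H : ℂ) =
      (1 / q : ℂ) * ∑ α ∈ farey Q with α.den ∣ q, oddSum H α * eChar (x * α) := by
  rw [Finset.mem_Icc] at hq
  have hq0 : q ≠ 0 := by omega
  have hqC : (q : ℂ) ≠ 0 := by exact_mod_cast hq0
  rw [← sum_range_div_eq_sum_farey hq0 hq.2 (fun α : ℚ => oddSum H α * eChar (x * α))]
  have hind : ∀ n : ℕ, (((if q ∣ n then 1 else 0 : ℝ)) : ℂ) =
      1 / q * ∑ j ∈ Finset.range q, eChar ((j / q : ℝ) * n) := by
    intro n
    have := sum_range_eChar_div q hq0 (n : ℤ)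
    push_cast at this
    rw [this]
    by_cases h : q ∣ n
    · rw [if_pos h, if_pos (Int.natCast_dvd_natCast.2 h)]; field_simp; simp
    · rw [if_neg h, if_neg (fun h' => h (Int.natCast_dvd_natCast.1 h'))]; simp
  rw [multDiff, Complex.ofReal_sum]
  simp only [Complex.ofReal_sub, hind, ← mul_sub, ← Finset.sum_sub_distrib]
  rw [← Finset.mul_sum, Finset.sum_comm]
  congr 1
  refine Finset.sum_congr rfl fun j _ => ?_
  rw [oddSum, Finset.sum_mul]
  refine Finset.sum_congr rfl fun h hh => ?_
  rw [Finset.mem_Icc] at hh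
  rw [sub_mul, ← eChar_add, ← eChar_add, Nat.cast_sub (by omega : h ≤ x)]
  congr 2 <;> (push_cast; ring)

theorem sum_filter_dvd_div_le {Q d : ℕ} (hd : d ≠ 0) (g : ℕ → ℝ) {B : ℝ} (hB0 : 0 ≤ B)
    (hB : ∀ q ∈ Finset.Icc 1 Q, g q ≤ B) :
    ∑ q ∈ Finset.Icc 1 Q with d ∣ q, g q / q ≤ B * harmSum Q / d := by
  calc ∑ q ∈ Finset.Icc 1 Q with d ∣ q, g q / q
      ≤ ∑ q ∈ Finset.Icc 1 Q with d ∣ q, B / q := by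
        refine Finset.sum_le_sum fun q hq => ?_
        have := hB q (Finset.mem_filter.1 hq).1
        gcongr
    _ ≤ ∑ q ∈ (Finset.Icc 1 Q).image (fun k => d * k), B / q := by
        refine Finset.sum_le_sum_of_subset_of_nonneg ?_ (fun _ _ _ => by positivity)
        intro q hq
        rw [Finset.mem_filter, Finset.mem_Icc] at hq
        obtain ⟨⟨h1, h2⟩, k, rfl⟩ := hq
        have hk : 0 < k := Nat.pos_of_mul_pos_left h1
        have : k ≤ d * k := Nat.le_mul_of_pos_left k (Nat.pos_of_ne_zero hd)
        exact Finset.mem_image.2 ⟨k, Finset.mem_Icc.2 ⟨hk, this.trans h2⟩, rfl⟩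
    _ = B * harmSum Q / d := by
        rw [Finset.sum_image (fun a _ b _ h => Nat.eq_of_mul_eq_mul_left (Nat.pos_of_ne_zero hd) h),
          harmSum, Finset.mul_sum, Finset.sum_div]
        refine Finset.sum_congr rfl fun k _ => ?_
        push_cast
        rw [mul_one_div, div_div, mul_comm (d : ℝ)]

/-- Mean square of a divisor-type combination of the differences `multDiff`. -/
theorem sum_sq_multDiff_le {N H D R : ℕ} {B : ℝ} (g : ℕ → ℝ) (hD : 0 < D) (hHN : H ≤ N)
    (hR : 2 * N ≤ R) (hg0 : ∀ q, 0 ≤ g q) (hB0 : 0 ≤ B) (hB : ∀ q ∈ Finset.Icc 1 R, g q ≤ B) :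
    ∑ x ∈ Finset.Ioc N (2 * N),
      (∑ q ∈ Finset.Icc 1 R, if q * D ≤ x then g q * multDiff q x H else 0) ^ 2 ≤
      (N + 2 * (((2 * N / D) ^ 2 : ℕ) * harmSum ((2 * N / D) ^ 2))) *
        (8 * H * harmSum (2 * N / D) ^ 4 * B ^ 2) := by
  set Q := 2 * N / D with hQ
  have hQR : Q ≤ R := (Nat.div_le_self _ _).trans hR
  set c : ℚ → ℕ → ℂ := fun α q => if α.den ∣ q then ((g q / q : ℝ) : ℂ) * oddSum H α else 0 with hc
  have hterm : ∀ x ∈ Finset.Ioc N (2 * N),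
      (∑ q ∈ Finset.Icc 1 R, if q * D ≤ x then g q * multDiff q x H else 0) ^ 2 =
      ‖∑ α ∈ farey Q, ∑ q ∈ Finset.Icc 1 Q,
        c α q * (if q * D ≤ x then eChar (x * α) else 0)‖ ^ 2 := by
    intro x hx
    rw [Finset.mem_Ioc] at hx
    have h1 : ∑ q ∈ Finset.Icc 1 R, (if q * D ≤ x then g q * multDiff q x H else 0) =
        ∑ q ∈ Finset.Icc 1 Q, if q * D ≤ x then g q * multDiff q x H else 0 := by
      symm
      refine Finset.sum_subset (Finset.Icc_subset_Icc le_rfl hQR) fun q hq hq' => ?_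
      rw [if_neg]
      intro h
      apply hq'
      rw [Finset.mem_Icc] at hq ⊢
      exact ⟨hq.1, (Nat.le_div_iff_mul_le hD).2 (h.trans hx.2)⟩
    have h2 : ((∑ q ∈ Finset.Icc 1 Q, if q * D ≤ x then g q * multDiff q x H else 0 : ℝ) : ℂ) =
        ∑ α ∈ farey Q, ∑ q ∈ Finset.Icc 1 Q,
          c α q * (if q * D ≤ x then eChar (x * α) else 0) := by
      rw [Complex.ofReal_sum, Finset.sum_comm]
      refine Finset.sum_congr rfl fun q hq => ?_
      by_cases h : q * D ≤ x
      · simp only [h, if_true, hc]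
        rw [Complex.ofReal_mul, ofReal_multDiff_eq hq (by omega : H ≤ x), Finset.sum_filter,
          Finset.mul_sum, Finset.mul_sum]
        refine Finset.sum_congr rfl fun α _ => ?_
        split_ifs
        · push_cast; ring
        · simp
      · simp [h]
    rw [h1, ← h2, Complex.norm_real, Real.norm_eq_abs, sq_abs]
  rw [Finset.sum_congr rfl hterm]
  refine (large_sieve_cutoff Q N (Finset.Icc 1 Q) (fun q => q * D) c).trans ?_
  have hpos : (0 : ℝ) ≤ N + 2 * ((Q ^ 2 : ℕ) * harmSum (Q ^ 2)) := by
    have := harmSum_nonneg (Q ^ 2); positivity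
  refine mul_le_mul_of_nonneg_left ?_ hpos
  have hα : ∀ α ∈ farey Q, (∑ q ∈ Finset.Icc 1 Q, ‖c α q‖) ^ 2 ≤
      (B * harmSum Q) ^ 2 * (‖oddSum H α‖ ^ 2 / (α.den : ℝ) ^ 2) := by
    intro α _
    have e : ∑ q ∈ Finset.Icc 1 Q, ‖c α q‖ =
        (∑ q ∈ Finset.Icc 1 Q with α.den ∣ q, g q / q) * ‖oddSum H α‖ := by
      rw [Finset.sum_filter, Finset.sum_mul]
      refine Finset.sum_congr rfl fun q _ => ?_
      simp only [hc]
      split_ifs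
      · rw [norm_mul, Complex.norm_real, Real.norm_eq_abs,
          abs_of_nonneg (div_nonneg (hg0 q) (Nat.cast_nonneg q))]
      · simp
    have hle := sum_filter_dvd_div_le α.den_ne_zero g hB0
      (fun q hq => hB q (Finset.Icc_subset_Icc le_rfl hQR hq))
    have h0 : 0 ≤ ∑ q ∈ Finset.Icc 1 Q with α.den ∣ q, g q / q :=
      Finset.sum_nonneg fun q _ => div_nonneg (hg0 q) (Nat.cast_nonneg q)
    rw [e, mul_pow]
    calc _ ≤ (B * harmSum Q / α.den) ^ 2 * ‖oddSum H α‖ ^ 2 := by gcongr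
      _ = _ := by ring
  refine (Finset.sum_le_sum hα).trans ?_
  rw [← Finset.mul_sum]
  calc _ ≤ (B * harmSum Q) ^ 2 * (8 * H * harmSum Q ^ 2) :=
        mul_le_mul_of_nonneg_left (sum_norm_oddSum_sq_le Q H) (sq_nonneg _)
    _ = _ := by ring

/-- An explicit bound for the symmetry integral of `d₃`. -/
theorem Jsgn_d3_le {N H T : ℕ} {B : ℝ} (hN : 0 < N) (hT : 2 * T ^ 3 ≤ N)
    (hHT : 2 * (H * (T + 1)) ≤ N)
    (hB : ∀ q ∈ Finset.Icc 1 (3 * N), pairWeight T q ≤ B) :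
    Jsgn (fun n => (d3 n : ℝ)) N H ≤
      2 * ((N + 2 * (((2 * N / (T + 1)) ^ 2 : ℕ) * harmSum ((2 * N / (T + 1)) ^ 2))) *
        (8 * H * harmSum (2 * N / (T + 1)) ^ 4 * B ^ 2)) +
      2 * (N * (2 * B * (2 * H / ((T + 1 : ℕ) : ℝ) + 1)) ^ 2) := by
  have hB0 : 0 ≤ B :=
    (pairWeight_nonneg T 1).trans (hB 1 (Finset.mem_Icc.2 ⟨le_rfl, by omega⟩))
  have hH : H ≤ H * (T + 1) := Nat.le_mul_of_pos_right _ (by omega)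
  have hmain := sum_sq_multDiff_le (N := N) (H := H) (D := T + 1) (R := 3 * N) (pairWeight T)
    (by omega) (by omega) (by omega) (pairWeight_nonneg T) hB0 hB
  set M : ℕ → ℝ := fun x => ∑ q ∈ Finset.Icc 1 (3 * N),
    if q * (T + 1) ≤ x then pairWeight T q * multDiff q x H else 0 with hM
  set E := 2 * B * (2 * H / ((T + 1 : ℕ) : ℝ) + 1) with hE
  have hx : ∀ x ∈ Finset.Ioc N (2 * N),
      (∑ n ∈ Finset.Icc (x - H) (x + H), (d3 n : ℝ) * sgn ((n : ℤ) - (x : ℤ))) ^ 2 ≤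
        2 * M x ^ 2 + 2 * E ^ 2 := by
    intro x hx
    rw [Finset.mem_Ioc] at hx
    have h := abs_oddSum_d3_sub_le (T := T) (x := x) (H := H) (R := 3 * N) (B := B)
      (by omega) (by omega) (by omega) hB (by omega)
    set S := ∑ n ∈ Finset.Icc (x - H) (x + H), (d3 n : ℝ) * sgn ((n : ℤ) - (x : ℤ))
    have h2 : (S - M x) ^ 2 ≤ E ^ 2 := sq_le_sq' (abs_le.1 h).1 (abs_le.1 h).2
    nlinarith [sq_nonneg (S - 2 * M x)]
  refine (Finset.sum_le_sum hx).trans ?_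
  rw [Finset.sum_add_distrib, ← Finset.mul_sum, Finset.sum_const, Nat.card_Ioc, nsmul_eq_mul,
    show 2 * N - N = N by omega]
  have : (N : ℝ) * (2 * E ^ 2) = 2 * (N * E ^ 2) := by ring
  rw [this]
  gcongr

theorem exists_harmSum_sq_le (ε : ℝ) (hε : 0 < ε) :
    ∃ K : ℝ, 0 < K ∧ ∀ N m : ℕ, 0 < N → m ≤ 2 * N → harmSum (m ^ 2) ≤ K * (N : ℝ) ^ ε := by
  refine ⟨1 + 2 * (2 ^ ε / ε), by positivity, fun N m hN hm => ?_⟩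
  have hX : (1 : ℝ) ≤ N := by exact_mod_cast hN
  have h1 : harmSum (m ^ 2) ≤ harmSum ((2 * N) ^ 2) := harmSum_mono (Nat.pow_le_pow_left hm 2)
  have h2 := harmSum_le ((2 * N) ^ 2)
  push_cast at h2
  rw [Real.log_pow] at h2
  have h3 := Real.log_le_rpow_div (x := 2 * N) (by positivity) hε
  rw [Real.mul_rpow (by norm_num) (by positivity)] at h3
  have h4 : (1 : ℝ) ≤ (N : ℝ) ^ ε := Real.one_le_rpow hX hε.le
  push_cast at h2
  calc harmSum (m ^ 2) ≤ 1 + 2 * Real.log (2 * N) := h1.trans h2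
    _ ≤ (N : ℝ) ^ ε + 2 * (2 ^ ε * (N : ℝ) ^ ε / ε) := by linarith
    _ = _ := by ring

theorem exists_pairWeight_le (ε : ℝ) (hε : 0 < ε) :
    ∃ K : ℝ, 0 < K ∧ ∀ N T : ℕ, ∀ q ∈ Finset.Icc 1 (3 * N),
      pairWeight T q ≤ K * (N : ℝ) ^ ε := by
  obtain ⟨C, hC1, hC⟩ := exists_card_divisors_le_rpow ε hε
  refine ⟨3 * (C * 3 ^ ε), by positivity, fun N T q hq => ?_⟩
  rw [Finset.mem_Icc] at hq
  have h1 := hC q (by omega)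
  have h2 : (q : ℝ) ^ ε ≤ 3 ^ ε * (N : ℝ) ^ ε := by
    rw [← Real.mul_rpow (by norm_num) (by positivity)]
    exact Real.rpow_le_rpow (by positivity) (by exact_mod_cast hq.2) hε.le
  calc pairWeight T q ≤ 3 * q.divisors.card := pairWeight_le T q
    _ ≤ 3 * (C * (3 ^ ε * (N : ℝ) ^ ε)) := by gcongr; exact h1.trans (by gcongr)
    _ = _ := by ring

theorem final_estimate {p y h W c c₁ Kl Kb Q L L' B t : ℝ} (hp : 1 ≤ p) (hy : 1 ≤ y)
    (hh : 0 < h) (hW : 0 < W) (hc : 0 < c) (hc₁ : 0 < c₁) (hKl : 0 < Kl) (hKb : 0 < Kb)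
    (hQ0 : 0 ≤ Q) (hQ : Q ≤ 4 * p ^ 2) (hL0 : 0 ≤ L) (hL : L ≤ Kl * y) (hL0' : 0 ≤ L')
    (hL' : L' ≤ Kl * y) (hB : B = Kb * y) (ht : p / 2 ≤ t)
    (hh1 : c₁ * (p * y ^ 14) ≤ h) (hh2 : h ^ 2 ≤ c * y ^ 7 * W) (hyp : y ^ 9 ≤ p ^ 2) :
    2 * ((p ^ 3 + 2 * (Q ^ 2 * L)) * (8 * h * L' ^ 4 * B ^ 2)) +
      2 * (p ^ 3 * (2 * B * (2 * h / t + 1)) ^ 2) ≤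
      (16 * (1 + 32 * Kl) * Kl ^ 4 * Kb ^ 2 * (c / c₁) +
        8 * Kb ^ 2 * (4 + 1 / c₁) ^ 2 * c) * p ^ 3 * W := by
  have hp0 : 0 < p := by linarith
  have hy0 : 0 < y := by linarith
  have hkey : p * y ^ 7 * h ≤ c / c₁ * W := by
    rw [div_mul_eq_mul_div, le_div_iff₀ hc₁]
    have h1 : c₁ * (p * y ^ 14) * h ≤ c * y ^ 7 * W := by
      calc _ ≤ h * h := by gcongr
        _ = h ^ 2 := by ring
        _ ≤ _ := hh2
    have h2 : y ^ 7 * (p * y ^ 7 * h * c₁) ≤ y ^ 7 * (c * W) := by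
      calc _ = c₁ * (p * y ^ 14) * h := by ring
        _ ≤ _ := h1
        _ = _ := by ring
    exact le_of_mul_le_mul_left h2 (by positivity)
  have first : 2 * ((p ^ 3 + 2 * (Q ^ 2 * L)) * (8 * h * L' ^ 4 * B ^ 2)) ≤
      16 * (1 + 32 * Kl) * Kl ^ 4 * Kb ^ 2 * (c / c₁) * p ^ 3 * W := by
    have h1 : p ^ 3 + 2 * (Q ^ 2 * L) ≤ (1 + 32 * Kl) * (p ^ 4 * y) := by
      have a1 : Q ^ 2 * L ≤ (4 * p ^ 2) ^ 2 * (Kl * y) := by gcongr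
      have a2 : p ^ 3 * 1 ≤ p ^ 4 * y :=
        mul_le_mul (pow_le_pow_right₀ hp (by norm_num)) hy zero_le_one (by positivity)
      nlinarith
    calc _ ≤ 2 * ((1 + 32 * Kl) * (p ^ 4 * y) * (8 * h * (Kl * y) ^ 4 * (Kb * y) ^ 2)) := by
          rw [hB]; gcongr
      _ = 16 * (1 + 32 * Kl) * Kl ^ 4 * Kb ^ 2 * p ^ 3 * (p * y ^ 7 * h) := by ring
      _ ≤ 16 * (1 + 32 * Kl) * Kl ^ 4 * Kb ^ 2 * p ^ 3 * (c / c₁ * W) := by gcongr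
      _ = _ := by ring
  have second : 2 * (p ^ 3 * (2 * B * (2 * h / t + 1)) ^ 2) ≤
      8 * Kb ^ 2 * (4 + 1 / c₁) ^ 2 * c * p ^ 3 * W := by
    have ht0 : 0 < t := lt_of_lt_of_le (by positivity) ht
    have h1 : 2 * h / t + 1 ≤ (4 + 1 / c₁) * (h / p) := by
      have a1 : 2 * h / t ≤ 4 * (h / p) := by
        rw [div_le_iff₀ ht0]
        calc 2 * h = 4 * (h / p) * (p / 2) := by field_simp; ring
          _ ≤ _ := by gcongr
      have a2 : 1 ≤ 1 / c₁ * (h / p) := by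
        rw [div_mul_div_comm, one_mul, one_le_div (by positivity)]
        refine le_trans ?_ hh1
        have : (1 : ℝ) ≤ y ^ 14 := one_le_pow₀ hy
        gcongr
        exact le_mul_of_one_le_right hp0.le this
      linarith
    have h2 : y ^ 2 * (h / p) ^ 2 ≤ c * W := by
      rw [div_pow, mul_div_assoc', div_le_iff₀ (by positivity)]
      calc y ^ 2 * h ^ 2 ≤ y ^ 2 * (c * y ^ 7 * W) := by gcongr
        _ = c * W * y ^ 9 := by ring
        _ ≤ _ := by gcongr
    calc _ ≤ 2 * (p ^ 3 * (2 * (Kb * y) * ((4 + 1 / c₁) * (h / p))) ^ 2) := by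
          rw [hB]; gcongr
      _ = 8 * Kb ^ 2 * (4 + 1 / c₁) ^ 2 * p ^ 3 * (y ^ 2 * (h / p) ^ 2) := by ring
      _ ≤ 8 * Kb ^ 2 * (4 + 1 / c₁) ^ 2 * p ^ 3 * (c * W) := by gcongr
      _ = _ := by ring
  linarith

theorem Jsgn_nonneg (f : ℕ → ℝ) (N H : ℕ) : 0 ≤ Jsgn f N H :=
  Finset.sum_nonneg fun _ _ => sq_nonneg _

theorem exists_Jsgn_d3_le_of_large {ϑ δ c₁ c₂ : ℝ} (h1 : 1 / 3 < ϑ) (h2 : ϑ < 1 / 2)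
    (hδ : δ = ϑ - 1 / 3) (hc₁ : 0 < c₁) (hc₂ : 0 < c₂) :
    ∃ (K : ℝ) (N₀ : ℕ), 0 < K ∧ ∀ N H : ℕ, N₀ ≤ N → 0 < N → 0 < H →
      c₁ * (N : ℝ) ^ ϑ ≤ (H : ℝ) → (H : ℝ) ≤ c₂ * (N : ℝ) ^ ϑ →
      Jsgn (fun n => (d3 n : ℝ)) N H ≤ K * (N : ℝ) * (H : ℝ) ^ (2 - δ) := by
  have hδ0 : 0 < δ := by linarith
  have hε : 0 < δ / 14 := by linarith
  obtain ⟨Kl, hKl, hl⟩ := exists_harmSum_sq_le _ hε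
  obtain ⟨Kb, hKb, hb⟩ := exists_pairWeight_le _ hε
  obtain ⟨N₀, hN₀⟩ := exists_nat_gt ((4 * c₂) ^ (1 / (2 / 3 - ϑ)))
  refine ⟨16 * (1 + 32 * Kl) * Kl ^ 4 * Kb ^ 2 * (c₂ ^ δ / c₁) +
        8 * Kb ^ 2 * (4 + 1 / c₁) ^ 2 * c₂ ^ δ, N₀, by positivity, ?_⟩
  intro N H hN hN0 hH0 hH1 hH2
  have hX : (1 : ℝ) ≤ N := by exact_mod_cast hN0
  have hX0 : (0 : ℝ) < N := by linarith
  set X : ℝ := (N : ℝ) with hXdef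
  set p : ℝ := X ^ (1 / 3 : ℝ) with hp
  set y : ℝ := X ^ (δ / 14) with hy
  have hp1 : 1 ≤ p := Real.one_le_rpow hX (by norm_num)
  have hy1 : 1 ≤ y := Real.one_le_rpow hX hε.le
  have hp3 : p ^ 3 = X := by
    rw [hp, ← Real.rpow_natCast, ← Real.rpow_mul hX0.le]; norm_num
  have hpow : ∀ n : ℕ, y ^ n = X ^ (δ / 14 * n) := fun n => by
    rw [hy, ← Real.rpow_natCast, ← Real.rpow_mul hX0.le]
  have hZ : X ^ ϑ = p * y ^ 14 := by
    rw [hpow, hp, ← Real.rpow_add hX0]; congr 1; push_cast; linarith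
  have hyp : y ^ 9 ≤ p ^ 2 := by
    rw [hpow, hp, ← Real.rpow_natCast, ← Real.rpow_mul hX0.le]
    exact Real.rpow_le_rpow_of_exponent_le hX (by push_cast; linarith)
  have hh : (0 : ℝ) < H := by exact_mod_cast hH0
  have hhd : (H : ℝ) ^ 2 ≤ c₂ ^ δ * y ^ 7 * (H : ℝ) ^ (2 - δ) := by
    have e : (H : ℝ) ^ 2 = (H : ℝ) ^ δ * (H : ℝ) ^ (2 - δ) := by
      rw [← Real.rpow_add hh, ← Real.rpow_natCast]; congr 1; push_cast; ring
    rw [e]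
    gcongr
    calc (H : ℝ) ^ δ ≤ (c₂ * X ^ ϑ) ^ δ := Real.rpow_le_rpow hh.le hH2 hδ0.le
      _ = c₂ ^ δ * X ^ (ϑ * δ) := by
          rw [Real.mul_rpow hc₂.le (by positivity), ← Real.rpow_mul hX0.le]
      _ ≤ _ := by
          rw [hpow]
          refine mul_le_mul_of_nonneg_left
            (Real.rpow_le_rpow_of_exponent_le hX ?_) (by positivity)
          push_cast; nlinarith
  -- the cutoff `T ≈ (N / 2) ^ (1 / 3)`
  set r : ℝ := (X / 2) ^ (1 / 3 : ℝ) with hr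
  have hr0 : 0 ≤ r := by positivity
  have hr3 : r ^ 3 = X / 2 := by
    rw [hr, ← Real.rpow_natCast, ← Real.rpow_mul (by positivity)]; norm_num
  have hrp : r ≤ p := Real.rpow_le_rpow (by positivity) (by linarith) (by norm_num)
  have hpr : p / 2 ≤ r := by
    refine le_of_pow_le_pow_left₀ three_ne_zero hr0 ?_
    rw [hr3, div_pow, hp3]; linarith
  set T : ℕ := ⌊r⌋₊ with hT
  have hTr : (T : ℝ) ≤ r := Nat.floor_le hr0
  have hrT : r ≤ ((T + 1 : ℕ) : ℝ) := by push_cast; exact (Nat.lt_floor_add_one r).le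
  have hT3 : 2 * T ^ 3 ≤ N := by
    have : (T : ℝ) ^ 3 ≤ r ^ 3 := by gcongr
    have h : (2 : ℝ) * (T : ℝ) ^ 3 ≤ N := by linarith
    exact_mod_cast h
  have hHT : 2 * (H * (T + 1)) ≤ N := by
    have a1 : 4 * c₂ ≤ X ^ (2 / 3 - ϑ) := by
      have hs : 0 < 2 / 3 - ϑ := by linarith
      calc 4 * c₂ = ((4 * c₂) ^ (1 / (2 / 3 - ϑ))) ^ (2 / 3 - ϑ) := by
            rw [← Real.rpow_mul (by positivity), one_div_mul_cancel hs.ne', Real.rpow_one]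
        _ ≤ _ := by
            refine Real.rpow_le_rpow (by positivity) (hN₀.le.trans ?_) hs.le
            rw [hXdef]; exact_mod_cast hN
    have a2 : (2 : ℝ) * (H * (T + 1)) ≤ X := by
      calc (2 : ℝ) * (H * (T + 1)) ≤ 2 * (c₂ * X ^ ϑ * (p + p)) := by
            gcongr; exact hTr.trans hrp
        _ = 4 * c₂ * (X ^ ϑ * p) := by ring
        _ ≤ X ^ (2 / 3 - ϑ) * (X ^ ϑ * p) := by gcongr
        _ = X := by
            rw [hp, ← Real.rpow_add hX0, ← Real.rpow_add hX0]
            conv_rhs => rw [← Real.rpow_one X]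
            congr 1; ring
    rw [hXdef] at a2
    exact_mod_cast a2
  have hJ := Jsgn_d3_le (B := Kb * y) hN0 hT3 hHT (fun q hq => hb N T q hq)
  refine hJ.trans ?_
  have hQN : 2 * N / (T + 1) ≤ 2 * N := Nat.div_le_self _ _
  have hQ : ((2 * N / (T + 1) : ℕ) : ℝ) ≤ 4 * p ^ 2 := by
    have a : ((2 * N / (T + 1) : ℕ) : ℝ) ≤ ((2 * N : ℕ) : ℝ) / ((T + 1 : ℕ) : ℝ) := Nat.cast_div_le
    refine a.trans ?_
    have ht : p / 2 ≤ ((T + 1 : ℕ) : ℝ) := hpr.trans hrT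
    rw [div_le_iff₀ (by positivity)]
    calc ((2 * N : ℕ) : ℝ) = 4 * p ^ 2 * (p / 2) := by
          push_cast; rw [← hXdef, ← hp3]; ring
      _ ≤ _ := by gcongr
  have hL := hl N _ hN0 hQN
  have hL' : harmSum (2 * N / (T + 1)) ≤ Kl * y :=
    (harmSum_mono (Nat.le_self_pow two_ne_zero _)).trans hL
  have hfin := final_estimate (c := c₂ ^ δ) hp1 hy1 hh (Real.rpow_pos_of_pos hh (2 - δ))
    (Real.rpow_pos_of_pos hc₂ δ) hc₁ hKl hKb (Nat.cast_nonneg _) hQ (harmSum_nonneg _) hL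
    (harmSum_nonneg _) hL' rfl (hpr.trans hrT) (by rw [← hZ]; exact hH1) hhd hyp
  rw [hp3] at hfin
  rw [Nat.cast_pow]
  exact hfin

theorem stmt1 :
    ∀ ϑ : ℝ, 1 / 3 < ϑ → ϑ < 1 / 2 →
      ∃ G' : ℝ, 0 < G' ∧ ∀ c₁ c₂ : ℝ, 0 < c₁ → c₁ < c₂ →
        ∃ C : ℝ, 0 < C ∧ ∀ N H : ℕ, 0 < N → 0 < H →
          c₁ * (N : ℝ) ^ ϑ ≤ (H : ℝ) → (H : ℝ) ≤ c₂ * (N : ℝ) ^ ϑ →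
          Jsgn (fun n => (d3 n : ℝ)) N H ≤ C * (N : ℝ) * (H : ℝ) ^ (2 - G') := by
  intro ϑ h1 h2
  refine ⟨ϑ - 1 / 3, by linarith, fun c₁ c₂ hc₁ hc₁₂ => ?_⟩
  have hc₂ : 0 < c₂ := hc₁.trans hc₁₂
  obtain ⟨K, N₀, hK, hlarge⟩ := exists_Jsgn_d3_le_of_large h1 h2 rfl hc₁ hc₂
  set F : ℕ × ℕ → ℝ := fun P => Jsgn (fun n => (d3 n : ℝ)) P.1 P.2 with hF
  set S := Finset.range N₀ ×ˢ Finset.range (⌊c₂ * N₀⌋₊ + 1) with hS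
  have hC₀ : 0 ≤ ∑ P ∈ S, F P := Finset.sum_nonneg fun P _ => Jsgn_nonneg _ _ _
  refine ⟨K + ∑ P ∈ S, F P, by linarith, fun N H hN hH hH1 hH2 => ?_⟩
  have hX : (1 : ℝ) ≤ N := by exact_mod_cast hN
  have hHr : (1 : ℝ) ≤ H := by exact_mod_cast hH
  have hpow : 1 ≤ (H : ℝ) ^ (2 - (ϑ - 1 / 3)) := Real.one_le_rpow hHr (by linarith)
  have hprod : 1 ≤ (N : ℝ) * (H : ℝ) ^ (2 - (ϑ - 1 / 3)) := one_le_mul_of_one_le_of_one_le hX hpow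
  rw [mul_assoc, add_mul]
  rcases le_or_gt N₀ N with h | h
  · have := hlarge N H h hN hH hH1 hH2
    rw [mul_assoc] at this
    nlinarith [mul_nonneg hC₀ (zero_le_one.trans hprod)]
  · have hmem : (N, H) ∈ S := by
      rw [hS, Finset.mem_product, Finset.mem_range, Finset.mem_range]
      refine ⟨h, Nat.lt_succ_of_le (Nat.le_floor (hH2.trans ?_))⟩
      gcongr
      calc (N : ℝ) ^ ϑ ≤ (N : ℝ) ^ (1 : ℝ) :=
            Real.rpow_le_rpow_of_exponent_le hX (by linarith)
        _ = N := Real.rpow_one _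
        _ ≤ N₀ := by exact_mod_cast h.le
    have hle : F (N, H) ≤ ∑ P ∈ S, F P :=
      Finset.single_le_sum (f := F) (fun P _ => Jsgn_nonneg _ _ _) hmem
    calc Jsgn (fun n => (d3 n : ℝ)) N H ≤ ∑ P ∈ S, F P := hle
      _ ≤ (∑ P ∈ S, F P) * ((N : ℝ) * (H : ℝ) ^ (2 - (ϑ - 1 / 3))) :=
          le_mul_of_one_le_right hC₀ hprod
      _ ≤ _ := le_add_of_nonneg_left (mul_nonneg hK.le (zero_le_one.trans hprod))
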